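/- For every natural number n, the number of triples (x,y,z) ∈ ℤ³ with n = x(x+1)/2 + y² + z² is greater than or equal to the number of triples (x,y,z) ∈ ℤ³ with n = x(x+1)/2 + 15y² + 15z². -/

import Mathlib

open ZMod in
lemma S_prime_mul (p m : ℕ) (hp : p.Prime) (hm : 0 < m) :
    ∑ d ∈ (p * m).divisors, χ₄ (d : ZMod 4) =
      ∑ d ∈ m.divisors, χ₄ (d : ZMod 4) + χ₄ (p : ZMod 4) * ∑ d ∈ m.divisors, χ₄ (d : ZMod 4)
      - χ₄ (p : ZMod 4) * (if p ∣ m then ∑ d ∈ (m / p).divisors, χ₄ (d : ZMod 4) else 0) := by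
  have hp0 := hp.pos
  have h1 : (p * m).divisors = m.divisors ∪ m.divisors.image (fun d => p * d) := by
    ext d
    simp only [Nat.mem_divisors, Finset.mem_union, Finset.mem_image]
    constructor
    · rintro ⟨h, -⟩
      by_cases hd : p ∣ d
      · obtain ⟨e, rfl⟩ := hd
        exact Or.inr ⟨e, ⟨(Nat.mul_dvd_mul_iff_left hp0).1 h, hm.ne'⟩, rfl⟩
      · refine Or.inl ⟨?_, hm.ne'⟩
        exact (Nat.Coprime.symm ((Nat.Prime.coprime_iff_not_dvd hp).2 hd)).dvd_of_dvd_mul_left h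
    · rintro (⟨h, -⟩ | ⟨e, ⟨h, -⟩, rfl⟩)
      · exact ⟨h.mul_left p, by positivity⟩
      · exact ⟨Nat.mul_dvd_mul_left p h, by positivity⟩
  have inj : Function.Injective (fun d => p * d) := fun a b h => Nat.eq_of_mul_eq_mul_left hp0 h
  have h2 : ∀ s : Finset ℕ, ∑ d ∈ s.image (fun d => p * d), χ₄ (d : ZMod 4) =
      χ₄ (p : ZMod 4) * ∑ d ∈ s, χ₄ (d : ZMod 4) := by
    intro s
    rw [Finset.sum_image (fun a _ b _ h => inj h), Finset.mul_sum]
    refine Finset.sum_congr rfl fun d _ => ?_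
    push_cast
    rw [map_mul]
  have h3 := Finset.sum_union_inter (s₁ := m.divisors) (s₂ := m.divisors.image (fun d => p * d))
    (f := fun d : ℕ => χ₄ (d : ZMod 4))
  have h4 : m.divisors ∩ m.divisors.image (fun d => p * d) =
      if p ∣ m then (m / p).divisors.image (fun d => p * d) else ∅ := by
    split_ifs with h
    · obtain ⟨k, rfl⟩ := h
      rw [Nat.mul_div_cancel_left k hp0]
      have hk : k ≠ 0 := by rintro rfl; simp at hm
      ext d
      simp only [Nat.mem_divisors, Finset.mem_inter, Finset.mem_image]
      constructor
      · rintro ⟨⟨h, -⟩, e, ⟨h', -⟩, rfl⟩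
        exact ⟨e, ⟨(Nat.mul_dvd_mul_iff_left hp0).1 h, hk⟩, rfl⟩
      · rintro ⟨e, ⟨h', -⟩, rfl⟩
        exact ⟨⟨Nat.mul_dvd_mul_left p h', hm.ne'⟩, e, ⟨h'.mul_left p, hm.ne'⟩, rfl⟩
    · ext d
      simp only [Nat.mem_divisors, Finset.mem_inter, Finset.mem_image, Finset.notMem_empty, iff_false]
      rintro ⟨⟨h1, -⟩, e, -, rfl⟩
      exact h (dvd_of_mul_right_dvd h1)
  rw [h1]
  rw [h2, h4] at h3
  split_ifs at h3 ⊢ with h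
  · rw [h2] at h3; linarith
  · rw [Finset.sum_empty] at h3; linarith

/-- representations as a sum of two squares -/
noncomputable def rep (k : ℤ) : Finset (ℤ × ℤ) :=
  (Finset.Icc (-k) k ×ˢ Finset.Icc (-k) k).filter (fun q => q.1 ^ 2 + q.2 ^ 2 = k)

lemma mem_rep (k : ℤ) (q : ℤ × ℤ) : q ∈ rep k ↔ q.1 ^ 2 + q.2 ^ 2 = k := by
  unfold rep
  simp only [Finset.mem_filter, Finset.mem_product, Finset.mem_Icc, and_iff_right_iff_imp]
  intro h
  refine ⟨⟨?_, ?_⟩, ?_, ?_⟩ <;> nlinarith [sq_nonneg q.1, sq_nonneg q.2, Int.le_self_sq q.1,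
    Int.le_self_sq q.2, Int.le_self_sq (-q.1), Int.le_self_sq (-q.2)]

lemma rep_scale (p : ℤ) (hp : 0 < p) (k : ℤ) :
    (rep (p * (p * k))).filter (fun q => p ∣ q.1 ∧ p ∣ q.2) =
      (rep k).image (fun q => (p * q.1, p * q.2)) := by
  ext ⟨y, z⟩
  simp only [Finset.mem_filter, mem_rep, Finset.mem_image, Prod.exists, Prod.mk.injEq]
  constructor
  · rintro ⟨h, ⟨a, rfl⟩, b, rfl⟩
    refine ⟨a, b, ?_, rfl, rfl⟩
    have : p * p * (a ^ 2 + b ^ 2 - k) = 0 := by linear_combination h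
    have h2 : p * p ≠ 0 := by positivity
    have := (mul_eq_zero.1 this).resolve_left h2
    linarith
  · rintro ⟨a, b, h, rfl, rfl⟩
    exact ⟨by rw [← h]; ring, dvd_mul_right _ _, dvd_mul_right _ _⟩

lemma card_rep_scale (p : ℤ) (hp : 0 < p) (k : ℤ) :
    ((rep (p * (p * k))).filter (fun q => p ∣ q.1 ∧ p ∣ q.2)).card = (rep k).card := by
  rw [rep_scale p hp, Finset.card_image_of_injective]
  rintro ⟨a, b⟩ ⟨c, d⟩ h
  simpa [hp.ne'] using h

lemma card_rep_rot (p u v : ℤ) (hp : Prime p) (h0 : 0 < p) (huv : u ^ 2 + v ^ 2 = p) (k : ℤ) :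
    ((rep (p * k)).filter (fun q => p ∣ q.1 * u + q.2 * v)).card = (rep k).card := by
  have : (rep (p * k)).filter (fun q => p ∣ q.1 * u + q.2 * v) =
      (rep k).image (fun q => (q.1 * u - q.2 * v, q.1 * v + q.2 * u)) := by
    ext ⟨y, z⟩
    simp only [Finset.mem_filter, mem_rep, Finset.mem_image, Prod.exists, Prod.mk.injEq]
    constructor
    · rintro ⟨h, a, ha⟩
      have h2 : p ∣ (z * u - y * v) ^ 2 := by
        refine ⟨p * k - p * a ^ 2, ?_⟩
        have : (y * u + z * v) ^ 2 + (z * u - y * v) ^ 2 = p * (p * k) := by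
          rw [← h, ← huv]; ring
        rw [ha] at this
        linarith
      obtain ⟨b, hb⟩ := hp.dvd_of_dvd_pow h2
      have e1 : p * (a * u - b * v) = p * y := by
        calc p * (a * u - b * v) = (p * a) * u - (p * b) * v := by ring
          _ = y * (u ^ 2 + v ^ 2) := by rw [← ha, ← hb]; ring
          _ = p * y := by rw [huv]; ring
      have e2 : p * (a * v + b * u) = p * z := by
        calc p * (a * v + b * u) = (p * a) * v + (p * b) * u := by ring
          _ = z * (u ^ 2 + v ^ 2) := by rw [← ha, ← hb]; ring
          _ = p * z := by rw [huv]; ring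
      have e1 := mul_left_cancel₀ h0.ne' e1
      have e2 := mul_left_cancel₀ h0.ne' e2
      refine ⟨a, b, ?_, e1, e2⟩
      apply mul_left_cancel₀ h0.ne'
      rw [← h, ← e1, ← e2, ← huv]; ring
    · rintro ⟨a, b, h, rfl, rfl⟩
      refine ⟨by rw [← h, ← huv]; ring, a, ?_⟩
      rw [← huv]; ring
  rw [this, Finset.card_image_of_injective]
  rintro ⟨a, b⟩ ⟨c, d⟩ h
  simp only [Prod.mk.injEq] at h ⊢
  obtain ⟨h1, h2⟩ := h
  have e1 : p * a = p * c := by rw [← huv]; linear_combination u * h1 + v * h2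
  have e2 : p * b = p * d := by rw [← huv]; linear_combination u * h2 - v * h1
  exact ⟨mul_left_cancel₀ h0.ne' e1, mul_left_cancel₀ h0.ne' e2⟩

lemma card_rep_three (p : ℕ) (hp : p.Prime) (h3 : p % 4 = 3) (m : ℕ) :
    (rep (p * m)).card = if p ∣ m then (rep ((m / p : ℕ) : ℤ)).card else 0 := by
  have hpp : Prime (p : ℤ) := Nat.prime_iff_prime_int.1 hp
  have h0 : (0 : ℤ) < p := by exact_mod_cast hp.pos
  have := Fact.mk hp
  have key : ∀ q ∈ rep ((p : ℤ) * m), (p : ℤ) ∣ q.1 ∧ (p : ℤ) ∣ q.2 := by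
    rintro ⟨y, z⟩ h
    rw [mem_rep] at h
    simp only at h ⊢
    have h1 : (y : ZMod p) ^ 2 + (z : ZMod p) ^ 2 = 0 := by
      have := congrArg (Int.cast : ℤ → ZMod p) h
      push_cast at this
      simpa using this
    have hz : (z : ZMod p) = 0 := by
      by_contra hz
      have : ((y : ZMod p) / z) ^ 2 = -1 := by
        field_simp
        linear_combination h1
      exact ZMod.mod_four_ne_three_of_sq_eq_neg_one this h3
    have hy : (y : ZMod p) = 0 := by
      rw [hz] at h1; simpa using h1
    exact ⟨(ZMod.intCast_zmod_eq_zero_iff_dvd y p).1 hy, (ZMod.intCast_zmod_eq_zero_iff_dvd z p).1 hz⟩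
  split_ifs with h
  · obtain ⟨k, rfl⟩ := h
    rw [Nat.mul_div_cancel_left k hp.pos]
    push_cast at key ⊢
    rw [← card_rep_scale p h0 k, Finset.filter_true_of_mem key]
  · rw [Finset.card_eq_zero, Finset.eq_empty_iff_forall_notMem]
    intro q hq
    obtain ⟨⟨a, ha⟩, b, hb⟩ := key q hq
    rw [mem_rep, ha, hb] at hq
    apply h
    have : (p : ℤ) ∣ m := ⟨a ^ 2 + b ^ 2, by
      apply mul_left_cancel₀ h0.ne'
      rw [← hq]; ring⟩
    exact_mod_cast this

lemma card_rep_two (m : ℤ) : (rep (2 * m)).card = (rep m).card := by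
  rw [← card_rep_rot 2 1 1 Int.prime_two (by norm_num) (by norm_num) m, Finset.filter_true_of_mem]
  rintro ⟨y, z⟩ h
  rw [mem_rep] at h
  simp only at h ⊢
  have h1 : Even (y ^ 2 + z ^ 2) := ⟨m, by linarith⟩
  have h2 : Even (y + z) := by
    have := h1
    simp only [Int.even_add, Int.even_pow, ne_eq, OfNat.ofNat_ne_zero, not_false_eq_true, and_true] at this ⊢
    exact this
  simpa using h2.two_dvd

lemma card_rep_one (p : ℕ) (hp : p.Prime) (h1 : p % 4 = 1) (m : ℕ) :
    (rep (p * m)).card + (if p ∣ m then (rep ((m / p : ℕ) : ℤ)).card else 0)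
      = 2 * (rep m).card := by
  have hpp : Prime (p : ℤ) := Nat.prime_iff_prime_int.1 hp
  have h0 : (0 : ℤ) < p := by exact_mod_cast hp.pos
  have := Fact.mk hp
  obtain ⟨u, v, huv⟩ := Nat.Prime.sq_add_sq (p := p) (by omega)
  have huv' : (u : ℤ) ^ 2 + (v : ℤ) ^ 2 = p := by exact_mod_cast huv
  have huv2 : (u : ℤ) ^ 2 + (-v : ℤ) ^ 2 = p := by rw [← huv']; ring
  have c1 := card_rep_rot p u v hpp h0 huv' m
  have c2 := card_rep_rot p u (-v) hpp h0 huv2 m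
  have hu : ¬ (p : ℤ) ∣ u := by
    intro h
    have h' : p ∣ u := by exact_mod_cast h
    have hv : p ∣ v := by
      have : p ∣ v ^ 2 := by
        have h2 : p ∣ u ^ 2 + v ^ 2 := by rw [huv]
        exact (Nat.dvd_add_right (Dvd.dvd.pow h' (by norm_num))).1 h2
      exact hp.dvd_of_dvd_pow this
    obtain ⟨a, rfl⟩ := h'
    obtain ⟨b, rfl⟩ := hv
    have h3 : p * (p * (a ^ 2 + b ^ 2)) = p * 1 := by rw [mul_one]; linarith
    have h4 := Nat.eq_of_mul_eq_mul_left hp.pos h3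
    exact hp.one_lt.ne' (Nat.eq_one_of_mul_eq_one_right h4)
  have hv : ¬ (p : ℤ) ∣ v := by
    intro h
    apply hu
    have : (p : ℤ) ∣ (u : ℤ) ^ 2 := ⟨1 - v * (v / p), by
      obtain ⟨b, hb⟩ := h
      rw [hb, Int.mul_ediv_cancel_left _ h0.ne', ← hb]
      nlinarith⟩
    exact hpp.dvd_of_dvd_pow this
  have h2 : ¬ (p : ℤ) ∣ 2 := by
    intro h
    have : p ∣ 2 := by exact_mod_cast h
    have := Nat.le_of_dvd (by norm_num) this
    have := hp.two_le
    interval_cases p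
    simp at h1
  have hun : (rep ((p : ℤ) * m)).filter (fun q => (p : ℤ) ∣ q.1 * u + q.2 * v) ∪
      (rep ((p : ℤ) * m)).filter (fun q => (p : ℤ) ∣ q.1 * u + q.2 * (-v)) = rep ((p : ℤ) * m) := by
    rw [← Finset.filter_or, Finset.filter_true_of_mem]
    rintro ⟨y, z⟩ h
    rw [mem_rep] at h
    simp only at h ⊢
    apply hpp.dvd_or_dvd
    refine ⟨m * u ^ 2 - z ^ 2, ?_⟩
    linear_combination (u : ℤ) ^ 2 * h - z ^ 2 * huv'
  have hin : (rep ((p : ℤ) * m)).filter (fun q => (p : ℤ) ∣ q.1 * u + q.2 * v) ∩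
      (rep ((p : ℤ) * m)).filter (fun q => (p : ℤ) ∣ q.1 * u + q.2 * (-v)) =
      (rep ((p : ℤ) * m)).filter (fun q => (p : ℤ) ∣ q.1 ∧ (p : ℤ) ∣ q.2) := by
    rw [← Finset.filter_and]
    apply Finset.filter_congr
    rintro ⟨y, z⟩ -
    simp only
    constructor
    · rintro ⟨ha, hb⟩
      have e1 : (p : ℤ) ∣ 2 * (y * u) := by
        have := dvd_add ha hb
        have e : ∀ s t : ℤ, s = t → (p : ℤ) ∣ s → (p : ℤ) ∣ t := fun s t h => h ▸ id
        exact e _ _ (by ring) this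
      have e2 : (p : ℤ) ∣ 2 * (z * v) := by
        have := dvd_sub ha hb
        have e : ∀ s t : ℤ, s = t → (p : ℤ) ∣ s → (p : ℤ) ∣ t := fun s t h => h ▸ id
        exact e _ _ (by ring) this
      exact ⟨((hpp.dvd_or_dvd ((hpp.dvd_or_dvd e1).resolve_left h2)).resolve_right hu),
        ((hpp.dvd_or_dvd ((hpp.dvd_or_dvd e2).resolve_left h2)).resolve_right hv)⟩
    · rintro ⟨ha, hb⟩
      exact ⟨dvd_add (ha.mul_right _) (hb.mul_right _), dvd_add (ha.mul_right _) (hb.mul_right _)⟩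
  have hc := Finset.card_union_add_card_inter
    ((rep ((p : ℤ) * m)).filter (fun q => (p : ℤ) ∣ q.1 * u + q.2 * v))
    ((rep ((p : ℤ) * m)).filter (fun q => (p : ℤ) ∣ q.1 * u + q.2 * (-v)))
  rw [hun, hin, c1, c2] at hc
  rw [two_mul, ← hc]
  congr 1
  split_ifs with h
  · obtain ⟨k, rfl⟩ := h
    rw [Nat.mul_div_cancel_left k hp.pos, ← card_rep_scale p h0]
    push_cast
    rfl
  · symm
    rw [Finset.card_eq_zero, Finset.eq_empty_iff_forall_notMem]
    intro q hq
    obtain ⟨hq, ⟨a, ha⟩, b, hb⟩ := Finset.mem_filter.1 hq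
    rw [mem_rep, ha, hb] at hq
    apply h
    have : (p : ℤ) ∣ m := ⟨a ^ 2 + b ^ 2, by
      apply mul_left_cancel₀ h0.ne'
      rw [← hq]; ring⟩
    exact_mod_cast this

open ZMod in
lemma card_rep_eq (m : ℕ) (hm : 0 < m) :
    ((rep (m : ℤ)).card : ℤ) = 4 * ∑ d ∈ m.divisors, χ₄ (d : ZMod 4) := by
  induction m using Nat.strong_induction_on with
  | _ m ih =>
    by_cases h1 : m = 1
    · subst h1
      decide
    · have hp := Nat.minFac_prime h1
      obtain ⟨k, hk⟩ := Nat.minFac_dvd m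
      set p := m.minFac with hpdef
      clear_value p
      subst hk
      have hk0 : 0 < k := Nat.pos_of_ne_zero (by rintro rfl; simp at hm)
      have ih1 := ih k (by nlinarith [hp.two_le]) hk0
      have ih2 : p ∣ k → ((rep ((k / p : ℕ) : ℤ)).card : ℤ) =
          4 * ∑ d ∈ (k / p).divisors, χ₄ (d : ZMod 4) := by
        intro h
        apply ih
        · have := Nat.div_le_self k p
          nlinarith [hp.two_le]
        · exact Nat.div_pos (Nat.le_of_dvd hk0 h) hp.pos
      rw [S_prime_mul p k hp hk0]
      have hcases : p = 2 ∨ p % 4 = 1 ∨ p % 4 = 3 := by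
        rcases hp.eq_two_or_odd with h | h
        · exact Or.inl h
        · omega
      rcases hcases with h | h | h
      · subst h
        have : χ₄ ((2 : ℕ) : ZMod 4) = 0 := by decide
        rw [this]
        push_cast
        rw [card_rep_two, ih1]
        ring
      · rw [χ₄_nat_one_mod_four h]
        have := card_rep_one p hp h k
        push_cast
        split_ifs at this ⊢ with hd
        · have i2 := ih2 hd
          zify at this
          push_cast at this i2
          linarith
        · zify at this
          linarith
      · rw [χ₄_nat_three_mod_four h]
        have := card_rep_three p hp h k
        push_cast
        rw [this]
        split_ifs with hd
        · have i2 := ih2 hd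
          rw [i2]; ring
        · simp

/-- the character mod 4 on integers -/
def ch (a : ℤ) : ℤ := if a % 2 = 0 then 0 else if a % 4 = 1 then 1 else -1

lemma ch_eq (a : ℤ) : ch a = ZMod.χ₄ (a : ZMod 4) := by
  rw [ZMod.χ₄_int_eq_if_mod_four]; rfl

lemma ch_neg (a : ℤ) : ch (-a) = -ch a := by
  unfold ch; split_ifs <;> omega

lemma ch_three (a : ℤ) : ch (3 * a) = -ch a := by
  unfold ch; split_ifs <;> omega

lemma ch_flip (a b c : ℤ) (hb : b % 2 = 1) : ch (a - 2 * b + 4 * c) = -ch a := by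
  unfold ch; split_ifs <;> omega

/-- indicator of not being divisible by three -/
def i3 (a : ℤ) : ℤ := if a % 3 = 0 then 0 else 1

lemma i3_neg (a : ℤ) : i3 (-a) = i3 a := by
  unfold i3; split_ifs <;> omega

/-- forms of discriminant N in a large box -/
noncomputable def U (N : ℤ) : Finset (ℤ × ℤ × ℤ) :=
  (Finset.Icc (-(10 * N)) (10 * N) ×ˢ Finset.Icc (-(10 * N)) (10 * N) ×ˢ
    Finset.Icc (-(10 * N)) (10 * N)).filter (fun q => q.2.1 ^ 2 - 4 * q.1 * q.2.2 = N)

lemma bound (N a b c : ℤ) (h : b ^ 2 - 4 * a * c = N) (ha : 0 < a) (hc : c < 0) :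
    a ≤ N ∧ -N ≤ c ∧ -N ≤ b ∧ b ≤ N := by
  have h1 : 0 < a * (-c) := by nlinarith
  refine ⟨?_, ?_, ?_, ?_⟩ <;> nlinarith [sq_nonneg b, Int.le_self_sq b, Int.le_self_sq (-b)]

lemma mem_U (N a b c : ℤ) : (a, b, c) ∈ U N ↔ (-(10 * N) ≤ a ∧ a ≤ 10 * N) ∧
    (-(10 * N) ≤ b ∧ b ≤ 10 * N) ∧ (-(10 * N) ≤ c ∧ c ≤ 10 * N) ∧ b ^ 2 - 4 * a * c = N := by
  unfold U
  simp only [Finset.mem_filter, Finset.mem_product, Finset.mem_Icc]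
  tauto

/-- forms with a > 0 > c -/
noncomputable def G (N : ℤ) : Finset (ℤ × ℤ × ℤ) := (U N).filter (fun q => 0 < q.1 ∧ q.2.2 < 0)

lemma mem_G (N a b c : ℤ) : (a, b, c) ∈ G N ↔ b ^ 2 - 4 * a * c = N ∧ 0 < a ∧ c < 0 := by
  unfold G
  simp only [Finset.mem_filter, mem_U]
  constructor
  · tauto
  · rintro ⟨h, ha, hc⟩
    have := bound N a b c h ha hc
    refine ⟨⟨?_, ?_, ?_, h⟩, ha, hc⟩ <;> constructor <;> linarith

/-- forms with a > 0 > a - b + c -/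
noncomputable def H (N : ℤ) : Finset (ℤ × ℤ × ℤ) :=
  (U N).filter (fun q => 0 < q.1 ∧ q.1 - q.2.1 + q.2.2 < 0)

lemma mem_H (N a b c : ℤ) : (a, b, c) ∈ H N ↔ b ^ 2 - 4 * a * c = N ∧ 0 < a ∧ a - b + c < 0 := by
  unfold H
  simp only [Finset.mem_filter, mem_U]
  constructor
  · tauto
  · rintro ⟨h, ha, hc⟩
    have := bound N a (b - 2 * a) (a - b + c) (by rw [← h]; ring) ha hc
    refine ⟨⟨?_, ?_, ?_, h⟩, ha, hc⟩ <;> constructor <;> linarith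

/-- forms with a - b + c > 0 > c -/
noncomputable def D (N : ℤ) : Finset (ℤ × ℤ × ℤ) :=
  (U N).filter (fun q => 0 < q.1 - q.2.1 + q.2.2 ∧ q.2.2 < 0)

lemma mem_D (N a b c : ℤ) : (a, b, c) ∈ D N ↔ b ^ 2 - 4 * a * c = N ∧ 0 < a - b + c ∧ c < 0 := by
  unfold D
  simp only [Finset.mem_filter, mem_U]
  constructor
  · tauto
  · rintro ⟨h, ha, hc⟩
    have := bound N (a - b + c) (b - 2 * c) c (by rw [← h]; ring) ha hc
    refine ⟨⟨?_, ?_, ?_, h⟩, ha, hc⟩ <;> constructor <;> linarith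

lemma b_odd (N a b c : ℤ) (hN : N % 2 = 1) (h : b ^ 2 - 4 * a * c = N) : b % 2 = 1 := by
  rcases Int.emod_two_eq_zero_or_one b with h0 | h0
  · exfalso
    obtain ⟨k, rfl⟩ := Int.dvd_of_emod_eq_zero h0
    have : N = 2 * (2 * k ^ 2 - 2 * a * c) := by rw [← h]; ring
    omega
  · exact h0

lemma sum_D (N : ℤ) (hN : N % 2 = 1) : ∑ q ∈ D N, ch q.1 * i3 q.2.2 = 0 := by
  have h : ∑ q ∈ D N, ch q.1 * i3 q.2.2 = ∑ q ∈ D N, -(ch q.1 * i3 q.2.2) := by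
    refine Finset.sum_nbij' (fun q => (q.1 - 2 * q.2.1 + 4 * q.2.2, 4 * q.2.2 - q.2.1, q.2.2))
      (fun q => (q.1 - 2 * q.2.1 + 4 * q.2.2, 4 * q.2.2 - q.2.1, q.2.2)) ?_ ?_ ?_ ?_ ?_
    · rintro ⟨a, b, c⟩ h
      rw [mem_D] at h ⊢
      refine ⟨by rw [← h.1]; ring, by linarith, h.2.2⟩
    · rintro ⟨a, b, c⟩ h
      rw [mem_D] at h ⊢
      refine ⟨by rw [← h.1]; ring, by linarith, h.2.2⟩
    · rintro ⟨a, b, c⟩ h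
      ext <;> simp only <;> ring
    · rintro ⟨a, b, c⟩ h
      ext <;> simp only <;> ring
    · rintro ⟨a, b, c⟩ h
      rw [mem_D] at h
      simp only
      rw [ch_flip _ _ _ (b_odd N a b c hN h.1)]
      ring
  rw [Finset.sum_neg_distrib] at h
  linarith

lemma sum_H (N : ℤ) : ∑ q ∈ G N, ch q.1 * i3 (q.1 + q.2.1 + q.2.2) = ∑ q ∈ H N, ch q.1 * i3 q.2.2 := by
  refine Finset.sum_nbij' (fun q => (q.1, q.2.1 + 2 * q.1, q.1 + q.2.1 + q.2.2))
      (fun q => (q.1, q.2.1 - 2 * q.1, q.1 - q.2.1 + q.2.2)) ?_ ?_ ?_ ?_ ?_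
  · rintro ⟨a, b, c⟩ h
    rw [mem_G] at h
    rw [mem_H]
    refine ⟨by rw [← h.1]; ring, by linarith, by linarith⟩
  · rintro ⟨a, b, c⟩ h
    rw [mem_H] at h
    rw [mem_G]
    refine ⟨by rw [← h.1]; ring, by linarith, by linarith⟩
  · rintro ⟨a, b, c⟩ h
    ext <;> simp only <;> ring
  · rintro ⟨a, b, c⟩ h
    ext <;> simp only <;> ring
  · rintro ⟨a, b, c⟩ h
    rfl

lemma sum_HG (N : ℤ) : ∑ q ∈ (H N).filter (fun q => 0 < q.2.2), ch q.1 * i3 q.2.2 =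
    - ∑ q ∈ (D N).filter (fun q => q.1 < 0), ch q.1 * i3 q.2.2 := by
  rw [← Finset.sum_neg_distrib]
  refine Finset.sum_nbij' (fun q => (-q.1, -q.2.1, -q.2.2)) (fun q => (-q.1, -q.2.1, -q.2.2))
    ?_ ?_ ?_ ?_ ?_
  · rintro ⟨a, b, c⟩ h
    simp only [Finset.mem_filter, mem_H, mem_D] at h ⊢
    refine ⟨⟨by rw [← h.1.1]; ring, by linarith, by linarith⟩, by linarith⟩
  · rintro ⟨a, b, c⟩ h
    simp only [Finset.mem_filter, mem_H, mem_D] at h ⊢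
    refine ⟨⟨by rw [← h.1.1]; ring, by linarith, by linarith⟩, by linarith⟩
  · rintro ⟨a, b, c⟩ h
    simp
  · rintro ⟨a, b, c⟩ h
    simp
  · rintro ⟨a, b, c⟩ h
    simp only [ch_neg, i3_neg]; ring

lemma G_sub_H (N : ℤ) (hN : N % 2 = 1) :
    ∑ q ∈ G N, ch q.1 * i3 q.2.2 - ∑ q ∈ H N, ch q.1 * i3 q.2.2 =
    ∑ q ∈ (G N).filter (fun q => q.1 - q.2.1 + q.2.2 = 0), ch q.1 * i3 q.2.2 := by
  set f : ℤ × ℤ × ℤ → ℤ := fun q => ch q.1 * i3 q.2.2 with hf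
  change ∑ q ∈ G N, f q - ∑ q ∈ H N, f q = ∑ q ∈ (G N).filter (fun q => q.1 - q.2.1 + q.2.2 = 0), f q
  have s1 : ∀ q : ℤ × ℤ × ℤ, q ∈ U N → (if 0 < q.1 ∧ q.2.2 < 0 then f q else 0)
      - (if 0 < q.1 ∧ q.1 - q.2.1 + q.2.2 < 0 then f q else 0) =
      (if (0 < q.1 ∧ q.2.2 < 0) ∧ q.1 - q.2.1 + q.2.2 = 0 then f q else 0)
      + (if 0 < q.1 - q.2.1 + q.2.2 ∧ q.2.2 < 0 then f q else 0)
      - (if (0 < q.1 - q.2.1 + q.2.2 ∧ q.2.2 < 0) ∧ q.1 < 0 then f q else 0)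
      - (if (0 < q.1 ∧ q.1 - q.2.1 + q.2.2 < 0) ∧ 0 < q.2.2 then f q else 0) := by
    rintro ⟨a, b, c⟩ -
    simp only
    by_cases ha : a = 0
    · subst ha
      have : f (0, b, c) = 0 := by simp [hf, ch]
      simp [this]
    by_cases hc : c = 0
    · subst hc
      have : f (a, b, 0) = 0 := by simp [hf, i3]
      simp [this]
    split_ifs <;> first | (exfalso; omega) | ring
  have s2 := Finset.sum_congr rfl s1
  simp only [Finset.sum_add_distrib, Finset.sum_sub_distrib, ← Finset.sum_filter] at s2
  simp only [← Finset.filter_filter] at s2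
  have e1 := sum_D N hN
  have e2 := sum_HG N
  unfold G H D at *
  simp only [← Finset.filter_filter] at *
  rw [s2]
  change ∑ q ∈ _, f q = 0 at e1
  change ∑ q ∈ _, f q = - ∑ q ∈ _, f q at e2
  linarith

lemma edge_nonneg (r : ℕ) (hr : r % 2 = 1) :
    0 ≤ ∑ a ∈ Finset.range r, ch a * i3 (a - r) := by
  have key : ∀ (k t : ℕ), t < 12 → t % 2 = 1 →
      0 ≤ ∑ a ∈ Finset.range (t + 12 * k), ch a * i3 (a - t) := by
    intro k t ht ht2
    induction k with
    | zero =>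
      interval_cases t <;> simp at ht2 <;> decide
    | succ k ih =>
      have : ∑ a ∈ Finset.range (t + 12 * (k + 1)), ch a * i3 (a - t) =
        ∑ a ∈ Finset.range (t + 12 * k), ch a * i3 (a - t) := by
        rw [show t + 12 * (k + 1) = (t + 12 * k) + 12 by ring, Finset.sum_range_add]
        have : ∑ x ∈ Finset.range 12, ch ((t + 12 * k + x : ℕ) : ℤ) * i3 ((t + 12 * k + x : ℕ) - t) =
          ∑ x ∈ Finset.range 12, ch ((t + x : ℕ) : ℤ) * i3 x := by
          refine Finset.sum_congr rfl fun x _ => ?_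
          congr 1
          · unfold ch; push_cast
            have h1 : ((t : ℤ) + 12 * k + x) % 2 = (t + x) % 2 := by omega
            have h2 : ((t : ℤ) + 12 * k + x) % 4 = (t + x) % 4 := by omega
            rw [h1, h2]
          · unfold i3; push_cast
            have h1 : ((t : ℤ) + 12 * k + x - t) % 3 = x % 3 := by omega
            rw [h1]
        rw [this]
        have h0 : ∑ x ∈ Finset.range 12, ch ((t + x : ℕ) : ℤ) * i3 x = 0 := by
          clear this ih
          interval_cases t <;> decide
        rw [h0, add_zero]
      rw [this]
      exact ih
  have h := key (r / 12) (r % 12) (Nat.mod_lt _ (by norm_num)) (by omega)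
  rw [Nat.mod_add_div] at h
  convert h using 3 with a
  unfold i3
  congr 1
  simp only [eq_iff_iff]
  push_cast
  omega

lemma edge_sum_nonneg (N : ℤ) (hN : N % 2 = 1) :
    0 ≤ ∑ q ∈ (G N).filter (fun q => q.1 - q.2.1 + q.2.2 = 0), ch q.1 * i3 q.2.2 := by
  by_cases hE : ((G N).filter (fun q => q.1 - q.2.1 + q.2.2 = 0)) = ∅
  · rw [hE]; simp
  obtain ⟨⟨a0, b0, c0⟩, h0⟩ := Finset.nonempty_iff_ne_empty.2 hE
  simp only [Finset.mem_filter, mem_G] at h0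
  obtain ⟨r, hr⟩ := Int.eq_ofNat_of_zero_le (show 0 ≤ a0 - c0 by linarith)
  have hrN : (r : ℤ) ^ 2 = N := by
    rw [← hr, ← h0.1.1, show b0 = a0 + c0 by linarith]; ring
  have hr2 : (r : ℤ) % 2 = 1 := b_odd N 0 r 0 hN (by rw [← hrN]; ring)
  have := edge_nonneg r (by omega)
  have h00 : ∑ a ∈ Finset.range r, ch a * i3 (a - r) =
      ∑ a ∈ (Finset.range r).filter (fun a => 0 < a), ch (a : ℤ) * i3 (a - r) := by
    symm
    apply Finset.sum_filter_of_ne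
    intro x _ hx
    rcases Nat.eq_zero_or_pos x with h | h
    · subst h; simp [ch] at hx
    · exact h
  rw [h00] at this
  convert this using 1
  refine Finset.sum_nbij' (fun q => q.1.toNat) (fun a => ((a : ℤ), 2 * (a : ℤ) - r, (a : ℤ) - r))
    ?_ ?_ ?_ ?_ ?_
  · rintro ⟨a, b, c⟩ h
    simp only [Finset.mem_filter, mem_G, Finset.mem_range] at h ⊢
    have h1 : (a - c - r) * (a - c + r) = 0 := by
      have : b = a + c := by linarith
      rw [this, ← hrN] at h
      linear_combination h.1.1
    have h2 : a - c = r := by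
      rcases mul_eq_zero.1 h1 with h3 | h3 <;> omega
    omega
  · intro a h
    simp only [Finset.mem_filter, mem_G, Finset.mem_range] at h ⊢
    refine ⟨⟨by rw [← hrN]; ring, by omega, by omega⟩, by ring⟩
  · rintro ⟨a, b, c⟩ h
    simp only [Finset.mem_filter, mem_G] at h
    have h1 : (a - c - r) * (a - c + r) = 0 := by
      have : b = a + c := by linarith
      rw [this, ← hrN] at h
      linear_combination h.1.1
    have h2 : a - c = r := by
      rcases mul_eq_zero.1 h1 with h3 | h3 <;> omega
    simp only [Prod.mk.injEq]
    omega
  · intro a h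
    simp
  · rintro ⟨a, b, c⟩ h
    simp only [Finset.mem_filter, mem_G] at h
    have h1 : (a - c - r) * (a - c + r) = 0 := by
      have : b = a + c := by linarith
      rw [this, ← hrN] at h
      linear_combination h.1.1
    have h2 : a - c = r := by
      rcases mul_eq_zero.1 h1 with h3 | h3 <;> omega
    simp only
    rw [show ((a.toNat : ℕ) : ℤ) = a by omega, show a - (r : ℤ) = c by omega]

lemma sum_three (N : ℤ) :
    ∑ q ∈ G N, ch q.1 * (i3 q.1 + i3 q.2.2) = 2 * ∑ q ∈ G N, ch q.1 := by
  have e : ∑ q ∈ (G N).filter (fun q => q.1 % 3 = 0), ch q.1 =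
      ∑ q ∈ (G N).filter (fun q => q.2.2 % 3 = 0), -ch q.1 := by
    refine Finset.sum_nbij' (fun q => (q.1 / 3, q.2.1, 3 * q.2.2))
      (fun q => (3 * q.1, q.2.1, q.2.2 / 3)) ?_ ?_ ?_ ?_ ?_
    · rintro ⟨a, b, c⟩ h
      simp only [Finset.mem_filter, mem_G] at h ⊢
      obtain ⟨⟨h1, h2, h3⟩, h4⟩ := h
      obtain ⟨k, rfl⟩ := Int.dvd_of_emod_eq_zero h4
      rw [Int.mul_ediv_cancel_left _ (by norm_num)]
      refine ⟨⟨by rw [← h1]; ring, by omega, by omega⟩, by omega⟩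
    · rintro ⟨a, b, c⟩ h
      simp only [Finset.mem_filter, mem_G] at h ⊢
      obtain ⟨⟨h1, h2, h3⟩, h4⟩ := h
      obtain ⟨k, rfl⟩ := Int.dvd_of_emod_eq_zero h4
      rw [Int.mul_ediv_cancel_left _ (by norm_num)]
      refine ⟨⟨by rw [← h1]; ring, by omega, by omega⟩, by omega⟩
    · rintro ⟨a, b, c⟩ h
      simp only [Finset.mem_filter, mem_G] at h
      obtain ⟨-, h4⟩ := h
      refine Prod.ext ?_ (Prod.ext rfl ?_)
      · simp only
        omega
      · simp only
        omega
    · rintro ⟨a, b, c⟩ h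
      simp only [Finset.mem_filter, mem_G] at h
      obtain ⟨-, h4⟩ := h
      refine Prod.ext ?_ (Prod.ext rfl ?_)
      · simp only
        omega
      · simp only
        omega
    · rintro ⟨a, b, c⟩ h
      simp only [Finset.mem_filter, mem_G] at h ⊢
      obtain ⟨k, rfl⟩ := Int.dvd_of_emod_eq_zero h.2
      rw [Int.mul_ediv_cancel_left _ (by norm_num), ch_three]
  rw [Finset.sum_filter, Finset.sum_filter] at e
  have e2 : ∀ q ∈ G N, ch q.1 * (i3 q.1 + i3 q.2.2) = 2 * ch q.1
      - (if q.1 % 3 = 0 then ch q.1 else 0) + (if q.2.2 % 3 = 0 then -ch q.1 else 0) := by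
    intro q _
    unfold i3
    split_ifs <;> ring
  rw [Finset.sum_congr rfl e2, Finset.sum_add_distrib, Finset.sum_sub_distrib, e, Finset.mul_sum]
  ring

lemma sum_refl (N : ℤ) : ∑ q ∈ G N, ch q.1 * i3 (q.1 - q.2.1 + q.2.2) =
    ∑ q ∈ G N, ch q.1 * i3 (q.1 + q.2.1 + q.2.2) := by
  refine Finset.sum_nbij' (fun q => (q.1, -q.2.1, q.2.2)) (fun q => (q.1, -q.2.1, q.2.2))
    ?_ ?_ ?_ ?_ ?_
  · rintro ⟨a, b, c⟩ h
    rw [mem_G] at h ⊢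
    exact ⟨by rw [← h.1]; ring, h.2⟩
  · rintro ⟨a, b, c⟩ h
    rw [mem_G] at h ⊢
    exact ⟨by rw [← h.1]; ring, h.2⟩
  · rintro ⟨a, b, c⟩ h
    simp
  · rintro ⟨a, b, c⟩ h
    simp
  · rintro ⟨a, b, c⟩ h
    rfl

lemma fiber (N b : ℤ) (m : ℕ) (hm : 0 < m) (h : b ^ 2 + 4 * m = N) (f : ℤ → ℤ → ℤ) :
    ∑ q ∈ (G N).filter (fun q => q.2.1 = b), f q.1 q.2.2 =
      ∑ d ∈ m.divisors, f d (-((m / d : ℕ) : ℤ)) := by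
  refine Finset.sum_nbij' (fun q => q.1.toNat) (fun d => ((d : ℤ), b, -((m / d : ℕ) : ℤ)))
    ?_ ?_ ?_ ?_ ?_
  · rintro ⟨a, b', c⟩ hq
    simp only [Finset.mem_filter, mem_G, Nat.mem_divisors] at hq ⊢
    obtain ⟨⟨h1, h2, h3⟩, rfl⟩ := hq
    refine ⟨?_, hm.ne'⟩
    have : (a.toNat : ℤ) ∣ m := by
      rw [Int.toNat_of_nonneg h2.le]
      exact ⟨-c, by linarith⟩
    exact_mod_cast this
  · intro d hd
    simp only [Finset.mem_filter, mem_G, Nat.mem_divisors] at hd ⊢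
    obtain ⟨⟨k, rfl⟩, -⟩ := hd
    have hd : 0 < d := Nat.pos_of_ne_zero (by rintro rfl; simp at hm)
    have hk : 0 < k := Nat.pos_of_ne_zero (by rintro rfl; simp at hm)
    rw [Nat.mul_div_cancel_left _ hd]
    push_cast at h
    refine ⟨⟨by rw [← h]; ring, by omega, by omega⟩, trivial⟩
  all_goals first | (intro d hd; simp; done) | skip
  all_goals
    rintro ⟨a, b', c⟩ hq
    simp only [Finset.mem_filter, mem_G] at hq
    obtain ⟨⟨h1, h2, h3⟩, rfl⟩ := hq
    obtain ⟨a, rfl⟩ := Int.eq_ofNat_of_zero_le h2.le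
    have hc : (m : ℤ) = a * (-c) := by linarith
    obtain ⟨k, hk⟩ := Int.eq_ofNat_of_zero_le (show 0 ≤ -c by linarith)
    rw [hk] at hc
    have hmk : m = a * k := by exact_mod_cast hc
    have : m / a = k := by rw [hmk]; exact Nat.mul_div_cancel_left _ (by omega)
    simp only [Int.toNat_natCast, this]
    try simp only [Prod.mk.injEq, true_and]
    rw [← hk]; simp

lemma fiber_empty (N b : ℤ) (h : ¬ ∃ m : ℕ, 0 < m ∧ b ^ 2 + 4 * m = N) :
    (G N).filter (fun q => q.2.1 = b) = ∅ := by
  rw [Finset.eq_empty_iff_forall_notMem]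
  rintro ⟨a, b', c⟩ hq
  simp only [Finset.mem_filter, mem_G] at hq
  obtain ⟨⟨h1, h2, h3⟩, rfl⟩ := hq
  apply h
  have : 0 < a * (-c) := by nlinarith
  refine ⟨(a * (-c)).toNat, by omega, ?_⟩
  rw [Int.toNat_of_nonneg this.le]
  linarith

lemma S_eq (m : ℕ) (hm : 0 < m) :
    4 * ∑ d ∈ m.divisors, ch (d : ℤ) = ((rep (m : ℤ)).card : ℤ) := by
  rw [card_rep_eq m hm]
  congr 1
  refine Finset.sum_congr rfl fun d _ => ?_
  rw [ch_eq]; push_cast; rfl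

lemma j_nonneg (N : ℤ) : 0 ≤ ∑ q ∈ G N, ch q.1 := by
  rw [← Finset.sum_fiberwise_of_maps_to (g := fun q => q.2.1) (t := (G N).image (fun q => q.2.1))
    (fun q hq => Finset.mem_image_of_mem _ hq)]
  refine Finset.sum_nonneg fun b _ => ?_
  by_cases h : ∃ m : ℕ, 0 < m ∧ b ^ 2 + 4 * m = N
  · obtain ⟨m, hm, h⟩ := h
    rw [fiber N b m hm h (fun a _ => ch a)]
    have := S_eq m hm
    have h2 : (0 : ℤ) ≤ ((rep (m : ℤ)).card : ℤ) := by positivity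
    linarith
  · rw [fiber_empty N b h]; simp

lemma z_nonpos (N : ℤ) :
    ∑ q ∈ (G N).filter (fun q => q.1 % 3 = 0 ∧ q.2.1 % 3 = 0 ∧ q.2.2 % 3 = 0), ch q.1 ≤ 0 := by
  by_cases h9 : (9 : ℤ) ∣ N
  · obtain ⟨M, rfl⟩ := h9
    have : ∑ q ∈ (G (9 * M)).filter (fun q => q.1 % 3 = 0 ∧ q.2.1 % 3 = 0 ∧ q.2.2 % 3 = 0), ch q.1
      = ∑ q ∈ G M, -ch q.1 := by
      refine Finset.sum_nbij' (fun q => (q.1 / 3, q.2.1 / 3, q.2.2 / 3))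
        (fun q => (3 * q.1, 3 * q.2.1, 3 * q.2.2)) ?_ ?_ ?_ ?_ ?_
      · rintro ⟨a, b, c⟩ h
        simp only [Finset.mem_filter, mem_G] at h ⊢
        obtain ⟨⟨h1, h2, h3⟩, h4, h5, h6⟩ := h
        obtain ⟨a, rfl⟩ := Int.dvd_of_emod_eq_zero h4
        obtain ⟨b, rfl⟩ := Int.dvd_of_emod_eq_zero h5
        obtain ⟨c, rfl⟩ := Int.dvd_of_emod_eq_zero h6
        simp only [Int.mul_ediv_cancel_left _ (show (3 : ℤ) ≠ 0 by norm_num)]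
        refine ⟨by linarith, by omega, by omega⟩
      · rintro ⟨a, b, c⟩ h
        simp only [Finset.mem_filter, mem_G] at h ⊢
        refine ⟨⟨by rw [← h.1]; ring, by omega, by omega⟩, by omega, by omega, by omega⟩
      · rintro ⟨a, b, c⟩ h
        simp only [Finset.mem_filter, mem_G, Prod.mk.injEq] at h ⊢
        omega
      · rintro ⟨a, b, c⟩ h
        simp only [Prod.mk.injEq] at h ⊢
        omega
      · rintro ⟨a, b, c⟩ h
        simp only [Finset.mem_filter, mem_G] at h ⊢
        obtain ⟨k, rfl⟩ := Int.dvd_of_emod_eq_zero h.2.1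
        rw [Int.mul_ediv_cancel_left _ (by norm_num), ch_three]
    rw [this, Finset.sum_neg_distrib]
    linarith [j_nonneg M]
  · rw [Finset.sum_eq_zero]
    rintro ⟨a, b, c⟩ h
    exfalso
    simp only [Finset.mem_filter, mem_G] at h
    obtain ⟨⟨h1, h2, h3⟩, h4, h5, h6⟩ := h
    obtain ⟨a, rfl⟩ := Int.dvd_of_emod_eq_zero h4
    obtain ⟨b, rfl⟩ := Int.dvd_of_emod_eq_zero h5
    obtain ⟨c, rfl⟩ := Int.dvd_of_emod_eq_zero h6
    exact h9 ⟨b ^ 2 - 4 * a * c, by rw [← h1]; ring⟩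

lemma emod3 (a b c N : ℤ) (h : b ^ 2 - 4 * a * c = N) :
    ((b % 3) ^ 2 - (a % 3) * (c % 3)) % 3 = N % 3 := by
  have e1 : b ≡ b % 3 [ZMOD 3] := (Int.mod_modEq b 3).symm
  have e2 : a ≡ a % 3 [ZMOD 3] := (Int.mod_modEq a 3).symm
  have e3 : c ≡ c % 3 [ZMOD 3] := (Int.mod_modEq c 3).symm
  have e4 : (4 : ℤ) ≡ 1 [ZMOD 3] := by decide
  have := ((e1.pow 2).sub ((e4.mul e2).mul e3))
  rw [h, one_mul] at this
  exact this.symm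

lemma count3 (a b c N : ℤ) (h : b ^ 2 - 4 * a * c = N) :
    i3 (a + b + c) + i3 (a - b + c) + i3 a + i3 c =
      if N % 3 = 1 then 2 else if N % 3 = 2 then 4 else
        3 - 3 * (if a % 3 = 0 ∧ b % 3 = 0 ∧ c % 3 = 0 then 1 else 0) := by
  have h1 := emod3 a b c N h
  have f1 : (a + b + c) % 3 = (a % 3 + b % 3 + c % 3) % 3 := by omega
  have f2 : (a - b + c) % 3 = (a % 3 - b % 3 + c % 3) % 3 := by omega
  unfold i3
  rw [f1, f2, ← h1]
  have ha : a % 3 = 0 ∨ a % 3 = 1 ∨ a % 3 = 2 := by omega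
  have hb : b % 3 = 0 ∨ b % 3 = 1 ∨ b % 3 = 2 := by omega
  have hc : c % 3 = 0 ∨ c % 3 = 1 ∨ c % 3 = 2 := by omega
  rcases ha with ha | ha | ha <;> rcases hb with hb | hb | hb <;> rcases hc with hc | hc | hc <;>
    rw [ha, hb, hc] <;> decide

lemma main_nonneg (N : ℤ) (hN : N % 2 = 1) : 0 ≤ ∑ q ∈ G N, ch q.1 * i3 q.2.2 := by
  have h1 := G_sub_H N hN
  have h2 := edge_sum_nonneg N hN
  rw [← sum_H] at h1
  have h3 := sum_three N
  have h4 := sum_refl N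
  suffices h : 0 ≤ ∑ q ∈ G N, ch q.1 * i3 (q.1 + q.2.1 + q.2.2) by linarith
  have h5 : ∑ q ∈ G N, ch q.1 * (i3 (q.1 + q.2.1 + q.2.2) + i3 (q.1 - q.2.1 + q.2.2) + i3 q.1 + i3 q.2.2) =
      2 * ∑ q ∈ G N, ch q.1 * i3 (q.1 + q.2.1 + q.2.2) + 2 * ∑ q ∈ G N, ch q.1 := by
    rw [← h3, two_mul]
    nth_rewrite 2 [← h4]
    rw [← Finset.sum_add_distrib, ← Finset.sum_add_distrib]
    refine Finset.sum_congr rfl fun q _ => by ring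
  have h6 : ∀ q ∈ G N, ch q.1 * (i3 (q.1 + q.2.1 + q.2.2) + i3 (q.1 - q.2.1 + q.2.2) + i3 q.1 + i3 q.2.2)
      = ch q.1 * (if N % 3 = 1 then 2 else if N % 3 = 2 then 4 else
        3 - 3 * (if q.1 % 3 = 0 ∧ q.2.1 % 3 = 0 ∧ q.2.2 % 3 = 0 then 1 else 0)) := by
    rintro ⟨a, b, c⟩ hq
    rw [mem_G] at hq
    rw [count3 a b c N hq.1]
  rw [Finset.sum_congr rfl h6] at h5
  have hj := j_nonneg N
  have hz := z_nonpos N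
  split_ifs at h5 with ha hb
  · rw [← Finset.sum_mul] at h5; linarith
  · rw [← Finset.sum_mul] at h5; linarith
  · rw [Finset.sum_filter] at hz
    have h7 : ∑ q ∈ G N, ch q.1 * (3 - 3 * (if q.1 % 3 = 0 ∧ q.2.1 % 3 = 0 ∧ q.2.2 % 3 = 0 then 1 else 0))
      = 3 * ∑ q ∈ G N, ch q.1 - 3 * ∑ q ∈ G N, (if q.1 % 3 = 0 ∧ q.2.1 % 3 = 0 ∧ q.2.2 % 3 = 0 then ch q.1 else 0) := by
      rw [Finset.mul_sum, Finset.mul_sum, ← Finset.sum_sub_distrib]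
      refine Finset.sum_congr rfl fun q _ => ?_
      split_ifs <;> ring
    rw [h7] at h5
    linarith

noncomputable def r3 (k : ℤ) : Finset (ℤ × ℤ) := if k % 3 = 0 then rep (k / 3) else ∅

lemma mem_r3 (k : ℤ) (q : ℤ × ℤ) : q ∈ r3 k ↔ 3 * q.1 ^ 2 + 3 * q.2 ^ 2 = k := by
  unfold r3
  split_ifs with h
  · rw [mem_rep]; omega
  · simp only [Finset.notMem_empty, false_iff]; omega

lemma rep_neg (k : ℤ) (h : k < 0) : rep k = ∅ := by
  refine Finset.eq_empty_of_forall_notMem fun q hq => ?_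
  rw [mem_rep] at hq
  nlinarith [sq_nonneg q.1, sq_nonneg q.2]

lemma r3_neg (k : ℤ) (h : k < 0) : r3 k = ∅ := by
  refine Finset.eq_empty_of_forall_notMem fun q hq => ?_
  rw [mem_r3] at hq
  nlinarith [sq_nonneg q.1, sq_nonneg q.2]

lemma r3_zero : r3 0 = rep 0 := by
  simp [r3]

lemma div_three (m : ℕ) (hm : 0 < m) :
    4 * ∑ d ∈ m.divisors, ch (d : ℤ) * i3 (-((m / d : ℕ) : ℤ)) =
      ((rep (m : ℤ)).card : ℤ) - ((r3 (m : ℤ)).card : ℤ) := by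
  have e : ∀ d ∈ m.divisors, ch (d : ℤ) * i3 (-((m / d : ℕ) : ℤ)) =
      ch (d : ℤ) - (if (m / d) % 3 = 0 then ch (d : ℤ) else 0) := by
    intro d _
    rw [i3_neg]
    unfold i3
    by_cases h : (m / d) % 3 = 0
    · rw [if_pos h, if_pos (by exact_mod_cast h)]; ring
    · rw [if_neg h, if_neg (by exact_mod_cast h)]; ring
  rw [Finset.sum_congr rfl e, Finset.sum_sub_distrib, mul_sub, S_eq m hm, ← Finset.sum_filter]
  congr 1
  by_cases h3 : m % 3 = 0
  · obtain ⟨t, rfl⟩ := Nat.dvd_of_mod_eq_zero h3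
    have ht : 0 < t := by omega
    have hr : r3 ((3 * t : ℕ) : ℤ) = rep (t : ℤ) := by
      ext q
      rw [mem_r3, mem_rep]; push_cast; omega
    rw [hr, ← S_eq t ht]
    congr 1
    refine Finset.sum_congr ?_ fun _ _ => rfl
    ext d
    simp only [Finset.mem_filter, Nat.mem_divisors]
    constructor
    · rintro ⟨⟨⟨c, hc⟩, h0⟩, h⟩
      have hd : 0 < d := by
        rcases Nat.eq_zero_or_pos d with rfl | hd
        · omega
        · exact hd
      rw [hc, Nat.mul_div_cancel_left _ hd] at h
      obtain ⟨u, rfl⟩ := Nat.dvd_of_mod_eq_zero h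
      refine ⟨⟨u, ?_⟩, by omega⟩
      have : 3 * t = 3 * (d * u) := by rw [hc]; ring
      omega
    · rintro ⟨⟨u, rfl⟩, h0⟩
      have hd : 0 < d := Nat.pos_of_ne_zero fun h => h0 (by simp [h])
      refine ⟨⟨⟨3 * u, by ring⟩, by omega⟩, ?_⟩
      rw [show 3 * (d * u) = d * (3 * u) by ring, Nat.mul_div_cancel_left _ hd]
      omega
  · have hr : r3 (m : ℤ) = ∅ := by
      unfold r3; rw [if_neg (by omega)]
    rw [hr, Finset.filter_false_of_mem]
    · simp
    · intro d hd h
      obtain ⟨u, hu⟩ := Nat.dvd_of_mod_eq_zero h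
      have := Nat.div_mul_cancel (Nat.dvd_of_mem_divisors hd)
      rw [hu] at this
      apply h3
      rw [← this, mul_assoc]; omega

lemma card_r3_two (k : ℤ) : (r3 (2 * k)).card = (r3 k).card := by
  unfold r3
  by_cases h : k % 3 = 0
  · rw [if_pos h, if_pos (by omega), show 2 * k / 3 = 2 * (k / 3) by omega, card_rep_two]
  · rw [if_neg h, if_neg (by omega)]

lemma fiber_id (N x k : ℤ) (h : (2 * x + 1) ^ 2 + 8 * k = N) :
    ((rep k).card : ℤ) - ((r3 k).card : ℤ) =
      4 * ∑ q ∈ (G N).filter (fun q => q.2.1 = 2 * x + 1), ch q.1 * i3 q.2.2 := by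
  rcases lt_trichotomy k 0 with hk | hk | hk
  · rw [fiber_empty N (2 * x + 1) (by rintro ⟨m, hm, h'⟩; omega), rep_neg k hk, r3_neg k hk]
    simp
  · rw [fiber_empty N (2 * x + 1) (by rintro ⟨m, hm, h'⟩; omega), hk, r3_zero]
    simp
  · obtain ⟨t, rfl⟩ := Int.eq_ofNat_of_zero_le hk.le
    have ht : 0 < 2 * t := by omega
    rw [fiber N (2 * x + 1) (2 * t) ht (by push_cast; rw [← h]; ring) (fun a c => ch a * i3 c),
      div_three _ ht, ← card_rep_two, ← card_r3_two]
    push_cast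
    rfl

lemma ncard_fib (s : Finset ℤ) (F : ℤ → Finset (ℤ × ℤ)) (A : Set (ℤ × ℤ × ℤ))
    (hA : ∀ p, p ∈ A ↔ p.1 ∈ s ∧ p.2 ∈ F p.1) :
    A.Finite ∧ A.ncard = ∑ x ∈ s, (F x).card := by
  classical
  have e : A = ↑((s.sigma F).map (Equiv.sigmaEquivProd ℤ (ℤ × ℤ)).toEmbedding) := by
    ext p
    rw [hA]
    simp only [Finset.coe_map, Set.mem_image, Finset.mem_coe, Finset.mem_sigma]
    constructor
    · intro h
      exact ⟨⟨p.1, p.2⟩, h, rfl⟩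
    · rintro ⟨⟨a, b⟩, h, rfl⟩
      exact h
  rw [e]
  refine ⟨Finset.finite_toSet _, ?_⟩
  rw [Set.ncard_coe_finset, Finset.card_map, Finset.card_sigma]

lemma tri (x : ℤ) : 8 * (x * (x + 1) / 2) = (2 * x + 1) ^ 2 - 1 := by
  have h : x * (x + 1) % 2 = 0 := by
    have := Int.even_mul_succ_self x
    exact Int.even_iff.mp this
  have : 2 * (x * (x + 1) / 2) = x * (x + 1) := by omega
  linear_combination 4 * this

lemma x_bd (x n : ℤ) (h : x * (x + 1) / 2 ≤ n) : x ∈ Finset.Icc (-(4 * n + 4)) (4 * n + 4) := by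
  have := tri x
  rw [Finset.mem_Icc]
  constructor <;> nlinarith

theorem triangular_square_count_ge (n : ℕ) :
    {p : ℤ × ℤ × ℤ | (n : ℤ) = p.1 * (p.1 + 1) / 2 + p.2.1 ^ 2 + p.2.2 ^ 2}.ncard ≥
    {p : ℤ × ℤ × ℤ | (n : ℤ) = p.1 * (p.1 + 1) / 2 + 15 * p.2.1 ^ 2 + 15 * p.2.2 ^ 2}.ncard := by
  set s : Finset ℤ := Finset.Icc (-(4 * (n : ℤ) + 4)) (4 * n + 4) with hs
  obtain ⟨-, h1⟩ := ncard_fib s (fun x => rep (n - x * (x + 1) / 2))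
    {p : ℤ × ℤ × ℤ | (n : ℤ) = p.1 * (p.1 + 1) / 2 + p.2.1 ^ 2 + p.2.2 ^ 2} (by
      intro p
      simp only [Set.mem_setOf_eq, mem_rep]
      constructor
      · intro h
        exact ⟨x_bd _ _ (by nlinarith [sq_nonneg p.2.1, sq_nonneg p.2.2]), by linarith⟩
      · rintro ⟨-, h⟩
        linarith)
  obtain ⟨f3, h3⟩ := ncard_fib s (fun x => r3 (n - x * (x + 1) / 2))
    {p : ℤ × ℤ × ℤ | (n : ℤ) = p.1 * (p.1 + 1) / 2 + 3 * p.2.1 ^ 2 + 3 * p.2.2 ^ 2} (by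
      intro p
      simp only [Set.mem_setOf_eq, mem_r3]
      constructor
      · intro h
        exact ⟨x_bd _ _ (by nlinarith [sq_nonneg p.2.1, sq_nonneg p.2.2]), by linarith⟩
      · rintro ⟨-, h⟩
        linarith)
  refine le_trans (b := {p : ℤ × ℤ × ℤ | (n : ℤ) =
    p.1 * (p.1 + 1) / 2 + 3 * p.2.1 ^ 2 + 3 * p.2.2 ^ 2}.ncard) ?_ ?_
  · refine Set.ncard_le_ncard_of_injOn
      (fun p => (p.1, 2 * p.2.1 - p.2.2, p.2.1 + 2 * p.2.2)) ?_ ?_ f3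
    · intro p hp
      simp only [Set.mem_setOf_eq] at hp ⊢
      rw [hp]; ring
    · rintro ⟨x, y, z⟩ - ⟨x', y', z'⟩ - h
      simp only [Prod.mk.injEq] at h ⊢
      omega
  · rw [h1, h3]
    have hN := main_nonneg (8 * n + 1) (by omega)
    have key : (∑ x ∈ s, ((rep (n - x * (x + 1) / 2)).card : ℤ)) -
        ∑ x ∈ s, ((r3 (n - x * (x + 1) / 2)).card : ℤ) =
        4 * ∑ q ∈ G (8 * n + 1), ch q.1 * i3 q.2.2 := by
      rw [← Finset.sum_sub_distrib, ← Finset.sum_fiberwise_of_maps_to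
        (s := G (8 * n + 1)) (t := s) (g := fun q => (q.2.1 - 1) / 2), Finset.mul_sum]
      · refine Finset.sum_congr rfl fun x _ => ?_
        rw [fiber_id (8 * n + 1) x _ (by linear_combination -tri x)]
        congr 1
        refine Finset.sum_congr ?_ fun _ _ => rfl
        ext ⟨a, b, c⟩
        simp only [Finset.mem_filter, mem_G]
        refine and_congr_right fun h => ?_
        have := b_odd (8 * n + 1) a b c (by omega) h.1
        omega
      · rintro ⟨a, b, c⟩ h
        rw [mem_G] at h
        have hb := b_odd (8 * n + 1) a b c (by omega) h.1
        have ht := tri ((b - 1) / 2)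
        have e : 2 * ((b - 1) / 2) + 1 = b := by omega
        rw [e] at ht
        refine x_bd _ _ ?_
        nlinarith [mul_pos h.2.1 (neg_pos.mpr h.2.2)]
    have : (∑ x ∈ s, ((r3 (n - x * (x + 1) / 2)).card : ℤ)) ≤
        ∑ x ∈ s, ((rep (n - x * (x + 1) / 2)).card : ℤ) := by linarith
    exact_mod_cast this
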